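/- arXiv:2009.11867 — 4 statements merged into one kernel-verified Lean document; each statement's English description precedes it below -/
import Mathlib

section
/- Let every employer have exactly one affiliate (r_e = 1 for all e ∈ E), and suppose |A| = |E| ≥ 2. Then for any matching μ, a pair (a, e) is a greedy blocking pair of μ (i.e., e ≻_a μ(a) and there exists γ ∈ E such that (a, γ) is a valid tuple and (a, γ) ≻_e (μ(e), μ(R_e))) if and only if there exists a matching μ′ such that μ′(a) = e, e ≻_a μ(a), and (a, μ′(R_e)) ≻_e (μ(e), μ(R_e)). -/
/-- If two types are equivalent, then any assignment of values to two points which respects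
equality and inequality extends to an equivalence. -/
theorem exists_equiv_apply_eq_apply_eq {α β : Type*} [DecidableEq β] (f : α ≃ β)
    {a b : α} {x y : β} (h : y = x ↔ a = b) : ∃ g : α ≃ β, g a = x ∧ g b = y := by
  let f₁ : α ≃ β := f.trans (Equiv.swap (f a) x)
  have hf₁ : f₁ a = x := by simp [f₁]
  by_cases hab : a = b
  · exact ⟨f₁, hf₁, by rw [← hab, hf₁, h.2 hab]⟩
  · refine ⟨f₁.trans (Equiv.swap (f₁ b) y), ?_, by simp⟩
    rw [Equiv.trans_apply, hf₁, Equiv.swap_apply_of_ne_of_ne]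
    · rw [← hf₁]
      exact f₁.injective.ne hab
    · exact fun hxy => hab (h.1 hxy.symm)


/-- with one affiliate per employer and |A| = |E| ≥ 2, the two
formulations of a greedy blocking pair coincide. -/
theorem greedy_blocking_pair_iff_exists_matching
    {A E : Type*} [Fintype A] [Fintype E] [DecidableEq A] [DecidableEq E]
    (hcard : Fintype.card A = Fintype.card E) (h2 : 2 ≤ Fintype.card A)
    (aff : E → A)
    (prefA : A → E → E → Prop) (hA : ∀ a, IsStrictTotalOrder E (prefA a))
    (prefE : E → A × E → A × E → Prop)
    (hE : ∀ e, IsStrictTotalOrder {p : A × E // p.1 = aff e ↔ p.2 = e}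
      (fun p q => prefE e p.1 q.1))
    (μ : A ≃ E) (a : A) (e : E) :
    (prefA a e (μ a) ∧ ∃ γ : E, (a = aff e ↔ γ = e) ∧
        prefE e (a, γ) (μ.symm e, μ (aff e))) ↔
      (∃ μ' : A ≃ E, μ' a = e ∧ prefA a e (μ a) ∧
        prefE e (a, μ' (aff e)) (μ.symm e, μ (aff e))) := by
  constructor
  · rintro ⟨ha, γ, hγ, he⟩
    obtain ⟨μ', hμ'a, hμ'γ⟩ := exists_equiv_apply_eq_apply_eq μ (a := a) (b := aff e) hγ.symm
    exact ⟨μ', hμ'a, ha, by rwa [hμ'γ]⟩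
  · rintro ⟨μ', rfl, ha, he⟩
    exact ⟨ha, μ' (aff (μ' a)), by rw [μ'.apply_eq_iff_eq, eq_comm], he⟩
end

section
/- Suppose |A| = |E| ≥ 2 and employer e's preference ≻_e is consistent with a strict total order ≻̄_e on A. Then for any matching μ and any applicant a, the pair (a, e) is a greedy blocking pair of μ if and only if e ≻_a μ(a) and a ≻̄_e μ(e). -/
/-- if employer `e`'s preference over valid outcome tuples is
consistent with a strict total order `prefBar` on applicants, then `(a, e)` is a
greedy blocking pair of `μ` iff `e ≻_a μ(a)` and `a ≻̄_e μ(e)`. -/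
theorem greedy_blocking_pair_iff_of_consistent
    {A E : Type*} [Fintype A] [Fintype E]
    (hcard : Fintype.card A = Fintype.card E) (h2 : 2 ≤ Fintype.card A)
    (r : E → ℕ) (R : (e : E) → Fin (r e) → A)
    (prefA : A → E → E → Prop) (hA : ∀ a, IsStrictTotalOrder E (prefA a))
    (e : E)
    (prefE : A × (Fin (r e) → E) → A × (Fin (r e) → E) → Prop)
    (hE : IsStrictTotalOrder {p : A × (Fin (r e) → E) // ∀ k, R e k = p.1 ↔ p.2 k = e}
      (fun p q => prefE p.1 q.1))
    (prefBar : A → A → Prop) (hBar : IsStrictTotalOrder A prefBar)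
    (hcons : ∀ p q : A × (Fin (r e) → E),
      (∀ k, R e k = p.1 ↔ p.2 k = e) → (∀ k, R e k = q.1 ↔ q.2 k = e) →
      prefE p q → p.1 ≠ q.1 → prefBar p.1 q.1)
    (μ : A ≃ E) (a : A) :
    (prefA a e (μ a) ∧ ∃ γ : Fin (r e) → E, (∀ k, R e k = a ↔ γ k = e) ∧
        prefE (a, γ) (μ.symm e, fun k => μ (R e k))) ↔
      (prefA a e (μ a) ∧ prefBar a (μ.symm e)) := by
  classical
  have irreflA : ∀ x, ¬ prefA a x x := (hA a).irrefl
  refine and_congr_right fun h => ?_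
  have hne : μ a ≠ e := fun he => irreflA e (by rwa [he] at h)
  have hne' : a ≠ μ.symm e := fun he => hne (by rw [he, μ.apply_symm_apply])
  have hvalid : ∀ k, R e k = μ.symm e ↔ μ (R e k) = e := fun k => μ.eq_symm_apply
  constructor
  · rintro ⟨γ, hγ, hpref⟩
    exact hcons _ _ hγ hvalid hpref hne'
  · intro hbar
    have hγ : ∀ k, R e k = a ↔ (if R e k = a then e else μ a) = e := by
      intro k
      by_cases hk : R e k = a <;> simp [hk, hne]
    refine ⟨fun k => if R e k = a then e else μ a, hγ, ?_⟩
    rcases trichotomous_of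
        (fun p q : {p : A × (Fin (r e) → E) // ∀ k, R e k = p.1 ↔ p.2 k = e} => prefE p.1 q.1)
        ⟨(a, fun k => if R e k = a then e else μ a), hγ⟩
        ⟨(μ.symm e, fun k => μ (R e k)), hvalid⟩ with hlt | heq | hgt
    · exact hlt
    · exact absurd (congrArg (fun p => p.1.1) heq) hne'
    · exact absurd (hcons _ _ hvalid hγ hgt hne'.symm) (asymm_of prefBar hbar)
end

section
/- Suppose |A| = |E| ≥ 2 and every employer e's preference ≻_e is consistent with a strict total order ≻̄_e on A (every employer is affiliate-agnostic). Then a matching μ is greedily stable if and only if μ is a stable matching of the stable marriage instance in which each applicant a has preferences ≻_a over E and each employer e has preferences ≻̄_e over A, i.e., if and only if there is no pair (a, e) with e ≻_a μ(a) and a ≻̄_e μ(e). -/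
/-- if every employer is affiliate-agnostic (its preference over
valid outcome tuples is consistent with a strict total order `prefBar e` on
applicants), then a matching `μ` is greedily stable iff it is a stable matching
of the induced stable marriage instance. -/
theorem greedily_stable_iff_stable_marriage_of_consistent
    {A E : Type*} [Fintype A] [Fintype E]
    (hcard : Fintype.card A = Fintype.card E) (h2 : 2 ≤ Fintype.card A)
    (r : E → ℕ) (R : (e : E) → Fin (r e) → A)
    (prefA : A → E → E → Prop) (hA : ∀ a, IsStrictTotalOrder E (prefA a))
    (prefE : (e : E) → A × (Fin (r e) → E) → A × (Fin (r e) → E) → Prop)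
    (hE : ∀ e, IsStrictTotalOrder
      {p : A × (Fin (r e) → E) // ∀ k, R e k = p.1 ↔ p.2 k = e}
      (fun p q => prefE e p.1 q.1))
    (prefBar : E → A → A → Prop) (hBar : ∀ e, IsStrictTotalOrder A (prefBar e))
    (hcons : ∀ (e : E) (p q : A × (Fin (r e) → E)),
      (∀ k, R e k = p.1 ↔ p.2 k = e) → (∀ k, R e k = q.1 ↔ q.2 k = e) →
      prefE e p q → p.1 ≠ q.1 → prefBar e p.1 q.1)
    (μ : A ≃ E) :
    (¬ ∃ (a : A) (e : E), prefA a e (μ a) ∧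
        ∃ γ : Fin (r e) → E, (∀ k, R e k = a ↔ γ k = e) ∧
          prefE e (a, γ) (μ.symm e, fun k => μ (R e k))) ↔
      (¬ ∃ (a : A) (e : E), prefA a e (μ a) ∧ prefBar e a (μ.symm e)) := by
  classical
  have hμ (e : E) : ∀ k, R e k = μ.symm e ↔ μ (R e k) = e := fun k => μ.eq_symm_apply
  have ne_of_pref {a : A} {e : E} (h : prefA a e (μ a)) : a ≠ μ.symm e := by
    rintro rfl
    have := hA (μ.symm e)
    rw [μ.apply_symm_apply] at h
    exact irrefl_of (prefA (μ.symm e)) e h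
  refine not_congr (exists_congr fun a => exists_congr fun e => and_congr_right fun hpref => ?_)
  constructor
  · rintro ⟨γ, hγ, hblock⟩
    exact hcons e _ _ hγ (hμ e) hblock (ne_of_pref hpref)
  · intro hbar
    have : Nontrivial E := Fintype.one_lt_card_iff_nontrivial.mp (by omega)
    obtain ⟨e', he'⟩ := exists_ne e
    have hγ : ∀ k, R e k = a ↔ (if R e k = a then e else e') = e := by
      intro k
      split_ifs with h <;> simp [h, he']
    refine ⟨fun k => if R e k = a then e else e', hγ, ?_⟩
    have := hE e
    have := hBar e
    rcases trichotomous_of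
        (fun p q : {p : A × (Fin (r e) → E) // ∀ k, R e k = p.1 ↔ p.2 k = e} => prefE e p.1 q.1)
        ⟨(a, fun k => if R e k = a then e else e'), hγ⟩
        ⟨(μ.symm e, fun k => μ (R e k)), hμ e⟩ with h | h | h
    · exact h
    · exact absurd (congrArg (fun p => p.1.1) h) (ne_of_pref hpref)
    · exact absurd (hcons e _ _ (hμ e) hγ h (ne_of_pref hpref).symm)
        (asymm_of (prefBar e) hbar)
end

section
/- Suppose |A| = |E| ≥ 2 and every employer e's preference ≻_e is consistent with a strict total order ≻̄_e on A (every employer is affiliate-agnostic). Then there exists a greedily stable matching μ. -/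
/-- Gale–Shapley: a two-sided matching market with equally many agents on both sides, each having a
strict total order on the other side, has a stable perfect matching. -/
theorem exists_stable_equiv {A E : Type*} [Fintype A] [Fintype E]
    (hcard : Fintype.card A = Fintype.card E)
    (prefA : A → E → E → Prop) (hA : ∀ a, IsStrictTotalOrder E (prefA a))
    (prefE : E → A → A → Prop) (hE : ∀ e, IsStrictTotalOrder A (prefE e)) :
    ∃ μ : A ≃ E, ∀ a e, prefA a e (μ a) → ¬ prefE e a (μ.symm e) := by
  classical
  rcases isEmpty_or_nonempty E with hempty | hne
  · exact ⟨Fintype.equivOfCardEq hcard, fun _ e => hempty.elim e⟩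
  have wf (a : A) : WellFounded (prefA a) := by
    have := hA a
    exact Finite.wellFounded_of_trans_of_irrefl _
  -- Proposal profiles in which every rejection was justified by a better proposal.
  let S : Set (A → E) := {p | ∀ a e, prefA a e (p a) → ∃ a', p a' = e ∧ prefE e a' a}
  have hS : S.Nonempty :=
    ⟨fun a => (wf a).min Set.univ Set.univ_nonempty, fun a e h =>
      ((wf a).not_lt_min Set.univ (Set.mem_univ e) h).elim⟩
  -- A profile with the most rejections is injective.
  obtain ⟨p, hpS, hmax⟩ := Set.exists_max_image S
    (fun p => ∑ a, (Finset.univ.filter fun e => prefA a e (p a)).card) S.toFinite hS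
  have hinj : Function.Injective p := by
    by_contra hnot
    obtain ⟨a, b, hpab, hab⟩ : ∃ a b, p a = p b ∧ prefE (p b) a b := by
      simp only [Function.Injective, not_forall] at hnot
      obtain ⟨a, b, hpab, hne⟩ := hnot
      have := hE (p b)
      rcases trichotomous_of (prefE (p b)) a b with h | h | h
      · exact ⟨a, b, hpab, h⟩
      · exact (hne h).elim
      · exact ⟨b, a, hpab.symm, hpab ▸ h⟩
    have hba : a ≠ b := by
      rintro rfl
      have := hE (p a)
      exact irrefl_of (prefE (p a)) a hab
    have hnext : {x | prefA b (p b) x}.Nonempty := by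
      by_contra hlast
      have hsurj : Function.Surjective p := by
        intro e
        have := hA b
        rcases trichotomous_of (prefA b) e (p b) with h | h | h
        · obtain ⟨a', ha', -⟩ := hpS b e h
          exact ⟨a', ha'⟩
        · exact ⟨b, h.symm⟩
        · exact (hlast ⟨e, h⟩).elim
      exact hnot ((Fintype.bijective_iff_surjective_and_card p).2 ⟨hsurj, hcard⟩).1
    let n := (wf b).min _ hnext
    have hn : prefA b (p b) n := (wf b).min_mem _ hnext
    have hbefore (e : E) (he : prefA b e n) : prefA b e (p b) ∨ e = p b := by
      have := hA b
      rcases trichotomous_of (prefA b) e (p b) with h | h | h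
      · exact .inl h
      · exact .inr h
      · exact ((wf b).not_lt_min _ h he).elim
    have hbetter (c : A) (e : E) (h : prefA c e (p c)) :
        ∃ a', a' ≠ b ∧ p a' = e ∧ prefE e a' c := by
      obtain ⟨a', rfl, h'⟩ := hpS c e h
      by_cases hb : a' = b
      · subst hb
        have := hE (p a')
        exact ⟨a, hba, hpab, trans_of (prefE (p a')) hab h'⟩
      · exact ⟨a', hb, rfl, h'⟩
    have hmem : Function.update p b n ∈ S := by
      intro c e h
      obtain ⟨a', hb, ha', h'⟩ : ∃ a', a' ≠ b ∧ p a' = e ∧ prefE e a' c := by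
        by_cases hc : c = b
        · subst hc
          rw [Function.update_self] at h
          rcases hbefore e h with h | rfl
          · exact hbetter c e h
          · exact ⟨a, hba, hpab, hab⟩
        · rw [Function.update_of_ne hc] at h
          exact hbetter c e h
      exact ⟨a', by rw [Function.update_of_ne hb, ha'], h'⟩
    refine (hmax _ hmem).not_gt (Finset.sum_lt_sum (fun c _ => ?_) ⟨b, Finset.mem_univ b, ?_⟩)
    · refine Finset.card_le_card fun e => ?_
      by_cases hc : c = b
      · subst hc
        have := hA c
        simpa using fun h => trans_of (prefA c) h hn
      · simp [Function.update_of_ne hc]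
    · have := hA b
      refine Finset.card_lt_card ((Finset.ssubset_iff_of_subset fun e => ?_).2 ⟨p b, ?_, ?_⟩)
      · simpa using fun h => trans_of (prefA b) h hn
      · simpa using hn
      · simpa using irrefl_of (prefA b) (p b)
  let μ := Equiv.ofBijective p ((Fintype.bijective_iff_injective_and_card p).2 ⟨hinj, hcard⟩)
  refine ⟨μ, fun a e h h' => ?_⟩
  obtain ⟨a', rfl, h''⟩ := hpS a e h
  have := hE (p a')
  have hμ : μ.symm (p a') = a' := μ.symm_apply_apply a'
  rw [hμ] at h'
  exact asymm_of (prefE (p a')) h' h''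


/-- if every employer is affiliate-agnostic (its preference over
valid outcome tuples is consistent with a strict total order `prefBar e` on
applicants), then a greedily stable matching exists. -/
theorem exists_greedily_stable_of_consistent
    {A E : Type*} [Fintype A] [Fintype E]
    (hcard : Fintype.card A = Fintype.card E) (h2 : 2 ≤ Fintype.card A)
    (r : E → ℕ) (R : (e : E) → Fin (r e) → A)
    (prefA : A → E → E → Prop) (hA : ∀ a, IsStrictTotalOrder E (prefA a))
    (prefE : (e : E) → A × (Fin (r e) → E) → A × (Fin (r e) → E) → Prop)
    (hE : ∀ e, IsStrictTotalOrder
      {p : A × (Fin (r e) → E) // ∀ k, R e k = p.1 ↔ p.2 k = e}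
      (fun p q => prefE e p.1 q.1))
    (prefBar : E → A → A → Prop) (hBar : ∀ e, IsStrictTotalOrder A (prefBar e))
    (hcons : ∀ (e : E) (p q : A × (Fin (r e) → E)),
      (∀ k, R e k = p.1 ↔ p.2 k = e) → (∀ k, R e k = q.1 ↔ q.2 k = e) →
      prefE e p q → p.1 ≠ q.1 → prefBar e p.1 q.1) :
    ∃ μ : A ≃ E, ¬ ∃ (a : A) (e : E), prefA a e (μ a) ∧
        ∃ γ : Fin (r e) → E, (∀ k, R e k = a ↔ γ k = e) ∧
          prefE e (a, γ) (μ.symm e, fun k => μ (R e k)) := by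
  obtain ⟨μ, hμ⟩ := exists_stable_equiv hcard prefA hA prefBar hBar
  refine ⟨μ, ?_⟩
  rintro ⟨a, e, hae, γ, hγ, hpref⟩
  refine hμ a e hae (hcons e _ _ hγ (fun k => μ.eq_symm_apply) hpref ?_)
  rintro rfl
  have := hA (μ.symm e)
  exact irrefl_of (prefA (μ.symm e)) e (by simpa using hae)
end
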